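/- Let G be a graph and let x, y be distinct vertices of G such that x and y are not adjacent and N(x) = N(y). Then G is perfect if and only if the induced subgraph G \ {x} is perfect. -/

import Mathlib

/-- A graph is perfect if every induced subgraph has clique number equal to
chromatic number. -/
def SimpleGraph.IsPerfect {V : Type*} (G : SimpleGraph V) : Prop :=
  ∀ A : Set V, (((G.induce A).cliqueNum : ℕ∞)) = (G.induce A).chromaticNumber

namespace SimpleGraph

variable {V W : Type*} {G : SimpleGraph V} {H : SimpleGraph W}

/-- A graph homomorphism maps cliques injectively onto cliques. -/
theorem IsNClique.exists_of_hom {n : ℕ} {s : Finset V} (hs : G.IsNClique n s) (f : G →g H) :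
    ∃ t, H.IsNClique n t := by
  classical
  refine ⟨s.image f, ?_, ?_⟩
  · intro a ha b hb hab
    simp only [Finset.coe_image, Set.mem_image] at ha hb
    obtain ⟨u, hu, rfl⟩ := ha
    obtain ⟨v, hv, rfl⟩ := hb
    exact f.map_adj (hs.isClique hu hv fun h => hab (h ▸ rfl))
  · rw [Finset.card_image_of_injOn, hs.card_eq]
    intro u hu v hv huv
    by_contra hne
    exact (f.map_adj (hs.isClique hu hv hne)).ne huv

/-- Homomorphically equivalent graphs have the same clique number. -/
theorem cliqueNum_eq_of_homs (f : G →g H) (g : H →g G) : G.cliqueNum = H.cliqueNum := by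
  unfold cliqueNum
  congr 1
  ext n
  exact ⟨fun ⟨_, hs⟩ => hs.exists_of_hom f, fun ⟨_, hs⟩ => hs.exists_of_hom g⟩

/-- Homomorphically equivalent graphs have the same chromatic number. -/
theorem chromaticNumber_eq_of_homs (f : G →g H) (g : H →g G) :
    G.chromaticNumber = H.chromaticNumber :=
  le_antisymm (chromaticNumber_le_of_forall_imp fun _ h => h.of_hom f)
    (chromaticNumber_le_of_forall_imp fun _ h => h.of_hom g)

/-- The pullback of a perfect graph along any map of vertices is perfect. -/
theorem IsPerfect.comap (hH : H.IsPerfect) (f : V → W) : (H.comap f).IsPerfect := by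
  intro A
  choose g hgA hg using fun w : f '' A => w.2
  let φ : (H.comap f).induce A →g H.induce (f '' A) :=
    ⟨fun a => ⟨f a, Set.mem_image_of_mem f a.2⟩, fun h => h⟩
  let ψ : H.induce (f '' A) →g (H.comap f).induce A :=
    ⟨fun w => ⟨g w, hgA w⟩, fun {a b} h => by
      change H.Adj (f (g a)) (f (g b))
      rw [hg, hg]
      exact h⟩
  rw [cliqueNum_eq_of_homs φ ψ, chromaticNumber_eq_of_homs φ ψ]
  exact hH _

end SimpleGraph

/-- If `x ≠ y` are non-adjacent vertices of a graph `G` with `N(x) = N(y)`, then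
`G` is perfect iff `G \ {x}` is perfect. -/
theorem stmt_15 {V : Type*} (G : SimpleGraph V) (x y : V) (hxy : x ≠ y)
    (hadj : ¬ G.Adj x y) (hN : G.neighborSet x = G.neighborSet y) :
    G.IsPerfect ↔ (G.induce {x}ᶜ).IsPerfect := by
  classical
  refine ⟨fun h => h.comap _, fun h => ?_⟩
  have hN' (v : V) : G.Adj x v ↔ G.Adj y v := Set.ext_iff.mp hN v
  let f : V → ({x}ᶜ : Set V) := fun v => if hv : v = x then ⟨y, hxy.symm⟩ else ⟨v, hv⟩
  have hf : (G.induce {x}ᶜ).comap f = G := by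
    ext a b
    change G.Adj (f a) (f b) ↔ G.Adj a b
    by_cases ha : a = x <;> by_cases hb : b = x <;>
      simp [f, ha, hb, hN', G.adj_comm _ x, G.adj_comm _ y]
  exact hf ▸ h.comap f
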